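/- Finite-blocklength converse for the Kaspi problem: under the stated regularity assumptions, for every γ > 0 and every n, M ∈ ℕ, every (n,M)-code satisfies P_{e,n}(D₁,D₂) ≥ Pr{ ∑_{i=1}^n ȷ_K(X_i,Y_i|D₁,D₂,P_{XY}) ≥ log M + nγ } − exp(−nγ). -/

import Mathlib

/-!
Finite-blocklength converse bound for the Kaspi problem
(Zhou–Motani, Theorem `fblconverse4kaspi`).
-/

open scoped BigOperators

noncomputable section

/-- Probability of an event under a pmf on a finite space. -/
def Pr {Ω : Type*} [Fintype Ω] (μ : Ω → ℝ) (A : Set Ω) : ℝ :=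
  ∑ ω, A.indicator μ ω

/-- Average per-letter distortion of a block. -/
def distn {α β : Type*} {n : ℕ} (d : α → β → ℝ) (xs : Fin n → α) (ys : Fin n → β) : ℝ :=
  (∑ i, d (xs i) (ys i)) / n

/-- i.i.d. law of the correlated pair `(X^n, Y^n)`. -/
def iidPairP {𝒳 𝒴 : Type*} (P : 𝒳 → 𝒴 → ℝ) (n : ℕ) :
    (Fin n → 𝒳) × (Fin n → 𝒴) → ℝ :=
  fun p => ∏ i, P (p.1 i) (p.2 i)

/-- A channel from pairs. -/
def IsChannel2 {𝒳 𝒴 A : Type*} [Fintype A] (W : 𝒳 → 𝒴 → A → ℝ) : Prop :=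
  ∀ x y, (∀ a, 0 ≤ W x y a) ∧ ∑ a, W x y a = 1

/-- A channel from triples. -/
def IsChannel3 {𝒳 𝒴 A B : Type*} [Fintype B] (W : 𝒳 → 𝒴 → A → B → ℝ) : Prop :=
  ∀ x y a, (∀ b, 0 ≤ W x y a b) ∧ ∑ b, W x y a b = 1

/-- Marginal law of `X̂₁`. -/
def PA {𝒳 𝒴 A : Type*} [Fintype 𝒳] [Fintype 𝒴] (P : 𝒳 → 𝒴 → ℝ)
    (W1 : 𝒳 → 𝒴 → A → ℝ) : A → ℝ :=
  fun a => ∑ x, ∑ y, P x y * W1 x y a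

/-- Conditional law `P_{X̂₂|Y X̂₁}`. -/
def PBgYA {𝒳 𝒴 A B : Type*} [Fintype 𝒳] (P : 𝒳 → 𝒴 → ℝ)
    (W1 : 𝒳 → 𝒴 → A → ℝ) (W2 : 𝒳 → 𝒴 → A → B → ℝ) : 𝒴 → A → B → ℝ :=
  fun y a b => (∑ x, P x y * W1 x y a * W2 x y a b) / (∑ x, P x y * W1 x y a)

/-- `I(XY;X̂₁)`. -/
def IK1 {𝒳 𝒴 A : Type*} [Fintype 𝒳] [Fintype 𝒴] [Fintype A]
    (P : 𝒳 → 𝒴 → ℝ) (W1 : 𝒳 → 𝒴 → A → ℝ) : ℝ :=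
  ∑ x, ∑ y, ∑ a, P x y * W1 x y a * Real.log (W1 x y a / PA P W1 a)

/-- `I(X;X̂₂|Y X̂₁)`. -/
def IK2 {𝒳 𝒴 A B : Type*} [Fintype 𝒳] [Fintype 𝒴] [Fintype A] [Fintype B]
    (P : 𝒳 → 𝒴 → ℝ) (W1 : 𝒳 → 𝒴 → A → ℝ) (W2 : 𝒳 → 𝒴 → A → B → ℝ) : ℝ :=
  ∑ x, ∑ y, ∑ a, ∑ b, P x y * W1 x y a * W2 x y a b *
    Real.log (W2 x y a b / PBgYA P W1 W2 y a b)

/-- The Kaspi rate-distortion function `R(P_{XY}, D₁, D₂)`. -/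
def RK {𝒳 𝒴 A B : Type*} [Fintype 𝒳] [Fintype 𝒴] [Fintype A] [Fintype B]
    (P : 𝒳 → 𝒴 → ℝ) (d1 : 𝒳 → A → ℝ) (d2 : 𝒳 → B → ℝ) (D1 D2 : ℝ) : ℝ :=
  sInf {r | ∃ (W1 : 𝒳 → 𝒴 → A → ℝ) (W2 : 𝒳 → 𝒴 → A → B → ℝ),
    IsChannel2 W1 ∧ IsChannel3 W2 ∧
    (∑ x, ∑ y, ∑ a, P x y * W1 x y a * d1 x a) ≤ D1 ∧
    (∑ x, ∑ y, ∑ a, ∑ b, P x y * W1 x y a * W2 x y a b * d2 x b) ≤ D2 ∧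
    r = IK1 P W1 + IK2 P W1 W2}

/-- The Kaspi distortions-tilted information density
`ȷ_K(x,y) = log α(x,y) − λ₁ D₁ − λ₂ D₂`. -/
def jKaspi {𝒳 𝒴 A B : Type*} [Fintype 𝒳] [Fintype 𝒴] [Fintype A] [Fintype B]
    (P : 𝒳 → 𝒴 → ℝ) (W1 : 𝒳 → 𝒴 → A → ℝ) (W2 : 𝒳 → 𝒴 → A → B → ℝ)
    (d1 : 𝒳 → A → ℝ) (d2 : 𝒳 → B → ℝ) (lam1 lam2 D1 D2 : ℝ) : 𝒳 → 𝒴 → ℝ :=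
  fun x y =>
    -Real.log (∑ a, PA P W1 a * Real.exp (-(lam1 * d1 x a)) *
        (∑ b, PBgYA P W1 W2 y a b * Real.exp (-(lam2 * d2 x b))))
      - lam1 * D1 - lam2 * D2

set_option linter.unusedSectionVars false

lemma ks_base {u p c : ℝ} (hu : 0 ≤ u) (hp : 0 ≤ p) (h : p = 0 → u = 0) (hc : 0 < c) :
    u * Real.log c + u - p * c ≤ u * Real.log (u / p) := by
  rcases hu.eq_or_lt with h0 | h0
  · subst h0
    have := mul_nonneg hp hc.le
    simp; linarith
  · have hp' : 0 < p := lt_of_le_of_ne hp (fun e => h0.ne' (h e.symm))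
    have h1 : Real.log (p * c / u) ≤ p * c / u - 1 := Real.log_le_sub_one_of_pos (by positivity)
    rw [Real.log_div (by positivity) h0.ne', Real.log_mul hp'.ne' hc.ne'] at h1
    rw [Real.log_div h0.ne' hp'.ne']
    have h2 := mul_le_mul_of_nonneg_left h1 hu
    have h3 : u * (p * c / u - 1) = p * c - u := by field_simp
    rw [h3] at h2
    linarith

lemma ks_logsum {u v p q : ℝ} (hu : 0 ≤ u) (hv : 0 ≤ v) (hp : 0 ≤ p) (hq : 0 ≤ q)
    (h1 : p = 0 → u = 0) (h2 : q = 0 → v = 0) :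
    (u + v) * Real.log ((u + v) / (p + q)) ≤ u * Real.log (u / p) + v * Real.log (v / q) := by
  rcases (add_nonneg hu hv).eq_or_lt with h0 | h0
  · have hu0 : u = 0 := by linarith
    have hv0 : v = 0 := by linarith
    simp [hu0, hv0]
  · have hpq : 0 < p + q := by
      rcases (add_nonneg hp hq).eq_or_lt with h | h
      · have := h1 (by linarith)
        have := h2 (by linarith)
        linarith
      · exact h
    have hc : 0 < (u + v) / (p + q) := by positivity
    have a1 := ks_base hu hp h1 hc
    have a2 := ks_base hv hq h2 hc
    have : (p + q) * ((u + v) / (p + q)) = u + v := by field_simp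
    nlinarith

/-- Scaled version: mixtures. -/
lemma ks_mix {u v p q t : ℝ} (hu : 0 ≤ u) (hv : 0 ≤ v) (hp : 0 ≤ p) (hq : 0 ≤ q)
    (h1 : p = 0 → u = 0) (h2 : q = 0 → v = 0) (ht0 : 0 < t) (ht1 : t < 1) :
    ((1 - t) * u + t * v) * Real.log (((1 - t) * u + t * v) / ((1 - t) * p + t * q)) ≤
      (1 - t) * (u * Real.log (u / p)) + t * (v * Real.log (v / q)) := by
  have hs : 0 < 1 - t := by linarith
  have := ks_logsum (mul_nonneg hs.le hu) (mul_nonneg ht0.le hv) (mul_nonneg hs.le hp)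
    (mul_nonneg ht0.le hq)
    (fun h => by rw [h1 ((mul_eq_zero.1 h).resolve_left hs.ne'), mul_zero])
    (fun h => by rw [h2 ((mul_eq_zero.1 h).resolve_left ht0.ne'), mul_zero])
  rw [mul_div_mul_left _ _ hs.ne', mul_div_mul_left _ _ ht0.ne'] at this
  linarith

lemma ks_deriv_le {g : ℝ → ℝ} {g' c : ℝ} (hg : HasDerivAt g g' 0)
    (h : ∀ t, 0 < t → t < 1 → g t - g 0 ≤ t * c) : g' ≤ c := by
  have h1 := (hasDerivAt_iff_tendsto_slope.1 hg).mono_left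
    (nhdsWithin_mono 0 (fun x (hx : x ∈ Set.Ioi (0:ℝ)) => ne_of_gt hx))
  refine le_of_tendsto h1 ?_
  filter_upwards [Ioo_mem_nhdsGT (zero_lt_one' ℝ)] with t ht
  rw [slope_def_field, sub_zero, div_le_iff₀ ht.1]
  linarith [h t ht.1 ht.2]

section KS
variable {𝒳 𝒴 A B : Type} [Fintype 𝒳] [Fintype 𝒴] [Fintype A] [Fintype B]

/-- Divergence of a joint test channel from a reproduction kernel. -/
def ksJ (P : 𝒳 → 𝒴 → ℝ) (V : 𝒳 → 𝒴 → A → B → ℝ) (S : 𝒴 → A → B → ℝ) : ℝ :=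
  ∑ x, ∑ y, ∑ a, ∑ b, P x y * (V x y a b * Real.log (V x y a b / S y a b))

/-- Sub-probability kernels whose first marginal is dominated independently of `y`. -/
def ksSub (S : 𝒴 → A → B → ℝ) : Prop :=
  (∀ y a b, 0 ≤ S y a b) ∧ ∃ q : A → ℝ, ∑ a, q a ≤ 1 ∧ ∀ y a, ∑ b, S y a b ≤ q a

lemma ks_factor (V : 𝒳 → 𝒴 → A → B → ℝ) (hV0 : ∀ x y a b, 0 ≤ V x y a b)
    (hV1 : ∀ x y, ∑ a, ∑ b, V x y a b = 1) (W2s : 𝒳 → 𝒴 → A → B → ℝ) (hW2 : IsChannel3 W2s) :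
    ∃ W1 : 𝒳 → 𝒴 → A → ℝ, ∃ W2 : 𝒳 → 𝒴 → A → B → ℝ, IsChannel2 W1 ∧ IsChannel3 W2 ∧
      ∀ x y a b, W1 x y a * W2 x y a b = V x y a b := by
  classical
  refine ⟨fun x y a => ∑ b, V x y a b,
    fun x y a b => if ∑ b, V x y a b = 0 then W2s x y a b else V x y a b / ∑ b, V x y a b,
    ?_, ?_, ?_⟩
  · exact fun x y => ⟨fun a => Finset.sum_nonneg fun b _ => hV0 x y a b, hV1 x y⟩
  · intro x y a
    by_cases h : ∑ b, V x y a b = 0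
    · simpa [h] using hW2 x y a
    · simp only [h, if_false]
      refine ⟨fun b => div_nonneg (hV0 x y a b) (Finset.sum_nonneg fun b _ => hV0 x y a b), ?_⟩
      rw [← Finset.sum_div, div_self h]
  · intro x y a b
    by_cases h : ∑ b, V x y a b = 0
    · have := (Finset.sum_eq_zero_iff_of_nonneg (fun b _ => hV0 x y a b)).1 h b (Finset.mem_univ _)
      simp [h, this]
    · simp only [h, if_false]
      field_simp

variable {P : 𝒳 → 𝒴 → ℝ} {W1 : 𝒳 → 𝒴 → A → ℝ} {W2 : 𝒳 → 𝒴 → A → B → ℝ}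

lemma ks_PA_pos (hP0 : ∀ x y, 0 ≤ P x y) (hW1 : IsChannel2 W1) {x y a} (hP : 0 < P x y)
    (h : 0 < W1 x y a) : 0 < PA P W1 a := by
  have h0 : ∀ x y, 0 ≤ P x y * W1 x y a := fun x y => mul_nonneg (hP0 x y) ((hW1 x y).1 a)
  calc 0 < P x y * W1 x y a := mul_pos hP h
    _ ≤ ∑ y, P x y * W1 x y a :=
      Finset.single_le_sum (f := fun y => P x y * W1 x y a) (fun y _ => h0 x y) (Finset.mem_univ y)
    _ ≤ _ := Finset.single_le_sum (f := fun x => ∑ y, P x y * W1 x y a)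
      (fun x _ => Finset.sum_nonneg fun y _ => h0 x y) (Finset.mem_univ x)

lemma ks_PB_nonneg (hP0 : ∀ x y, 0 ≤ P x y) (hW1 : IsChannel2 W1) (hW2 : IsChannel3 W2) (y a b) :
    0 ≤ PBgYA P W1 W2 y a b :=
  div_nonneg (Finset.sum_nonneg fun x _ => mul_nonneg (mul_nonneg (hP0 x y) ((hW1 x y).1 a))
    ((hW2 x y a).1 b))
    (Finset.sum_nonneg fun x _ => mul_nonneg (hP0 x y) ((hW1 x y).1 a))

lemma ks_PB_pos (hP0 : ∀ x y, 0 ≤ P x y) (hW1 : IsChannel2 W1) (hW2 : IsChannel3 W2)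
    {x y a b} (hP : 0 < P x y)
    (h : 0 < W1 x y a) (h' : 0 < W2 x y a b) : 0 < PBgYA P W1 W2 y a b := by
  have h0 : ∀ x, 0 ≤ P x y * W1 x y a := fun x => mul_nonneg (hP0 x y) ((hW1 x y).1 a)
  refine div_pos ?_ ?_
  · exact (mul_pos (mul_pos hP h) h').trans_le
      (Finset.single_le_sum (f := fun x => P x y * W1 x y a * W2 x y a b)
        (fun x _ => mul_nonneg (h0 x) ((hW2 x y a).1 b)) (Finset.mem_univ x))
  · exact (mul_pos hP h).trans_le
      (Finset.single_le_sum (f := fun x => P x y * W1 x y a) (fun x _ => h0 x) (Finset.mem_univ x))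

lemma ks_PA_nonneg (hP0 : ∀ x y, 0 ≤ P x y) (hW1 : IsChannel2 W1) (a) : 0 ≤ PA P W1 a :=
  Finset.sum_nonneg fun x _ => Finset.sum_nonneg fun y _ => mul_nonneg (hP0 x y) ((hW1 x y).1 a)

/-- The kernel induced by test channels. -/
def ksS (P : 𝒳 → 𝒴 → ℝ) (W1 : 𝒳 → 𝒴 → A → ℝ) (W2 : 𝒳 → 𝒴 → A → B → ℝ) : 𝒴 → A → B → ℝ :=
  fun y a b => PA P W1 a * PBgYA P W1 W2 y a b

lemma ks_sub (hP0 : ∀ x y, 0 ≤ P x y) (hP1 : ∑ x, ∑ y, P x y = 1) (hW1 : IsChannel2 W1)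
    (hW2 : IsChannel3 W2) : ksSub (ksS P W1 W2) := by
  refine ⟨fun y a b => mul_nonneg (ks_PA_nonneg hP0 hW1 a) (ks_PB_nonneg hP0 hW1 hW2 y a b),
    PA P W1, ?_, ?_⟩
  · unfold PA
    rw [Finset.sum_comm, ← hP1]
    refine le_of_eq (Finset.sum_congr rfl fun x _ => ?_)
    rw [Finset.sum_comm]
    refine Finset.sum_congr rfl fun y _ => ?_
    rw [← Finset.mul_sum, (hW1 x y).2, mul_one]
  · intro y a
    unfold ksS PBgYA
    rw [← Finset.mul_sum, ← Finset.sum_div, Finset.sum_comm]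
    have : ∀ x, ∑ b, P x y * W1 x y a * W2 x y a b = P x y * W1 x y a := fun x => by
      rw [← Finset.mul_sum, (hW2 x y a).2, mul_one]
    simp only [this]
    exact mul_le_of_le_one_right (ks_PA_nonneg hP0 hW1 a) (div_self_le_one _)

lemma ks_dom (hP0 : ∀ x y, 0 ≤ P x y) (hW1 : IsChannel2 W1)
    (hW2 : IsChannel3 W2) (x y a b) (hP : 0 < P x y) (h : ksS P W1 W2 y a b = 0) :
    W1 x y a * W2 x y a b = 0 := by
  by_contra hne
  have h1 : 0 < W1 x y a := lt_of_le_of_ne ((hW1 x y).1 a) (Ne.symm (left_ne_zero_of_mul hne))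
  have h2 : 0 < W2 x y a b := lt_of_le_of_ne ((hW2 x y a).1 b) (Ne.symm (right_ne_zero_of_mul hne))
  exact (mul_pos (ks_PA_pos hP0 hW1 hP h1) (ks_PB_pos hP0 hW1 hW2 hP h1 h2)).ne' h

lemma ks_IK_eq (hP0 : ∀ x y, 0 ≤ P x y) (hW1 : IsChannel2 W1) (hW2 : IsChannel3 W2) :
    IK1 P W1 + IK2 P W1 W2 = ksJ P (fun x y a b => W1 x y a * W2 x y a b) (ksS P W1 W2) := by
  unfold IK1 IK2 ksJ
  simp only [← Finset.sum_add_distrib]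
  refine Finset.sum_congr rfl fun x _ => Finset.sum_congr rfl fun y _ =>
    Finset.sum_congr rfl fun a _ => ?_
  have : P x y * W1 x y a * Real.log (W1 x y a / PA P W1 a) =
      ∑ b, P x y * W1 x y a * W2 x y a b * Real.log (W1 x y a / PA P W1 a) := by
    rw [← Finset.sum_mul, ← Finset.mul_sum, (hW2 x y a).2, mul_one]
  rw [this, ← Finset.sum_add_distrib]
  refine Finset.sum_congr rfl fun b _ => ?_
  rcases (hP0 x y).eq_or_lt with h | h
  · simp [← h]
  rcases ((hW1 x y).1 a).eq_or_lt with h1 | h1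
  · simp [← h1]
  rcases ((hW2 x y a).1 b).eq_or_lt with h2 | h2
  · simp [← h2]
  have h3 := ks_PA_pos hP0 hW1 h h1
  have h4 := ks_PB_pos hP0 hW1 hW2 h h1 h2
  unfold ksS
  rw [mul_div_mul_comm, Real.log_mul (by positivity) (by positivity)]
  ring

lemma ks_V_sum (hP1 : ∑ x, ∑ y, P x y = 1) (hW1 : IsChannel2 W1) (hW2 : IsChannel3 W2) :
    ∑ x, ∑ y, ∑ a, ∑ b, P x y * (W1 x y a * W2 x y a b) = 1 := by
  rw [← hP1]
  refine Finset.sum_congr rfl fun x _ => Finset.sum_congr rfl fun y _ => ?_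
  simp only [← Finset.mul_sum, (hW2 x y _).2, mul_one, (hW1 x y).2]

lemma ks_S_sum {S : 𝒴 → A → B → ℝ} (hS : ksSub S) (y) : ∑ a, ∑ b, S y a b ≤ 1 := by
  obtain ⟨_, q, hq, h⟩ := hS
  exact (Finset.sum_le_sum fun a _ => h y a).trans hq

lemma ks_IK_nonneg (hP0 : ∀ x y, 0 ≤ P x y) (hP1 : ∑ x, ∑ y, P x y = 1) (hW1 : IsChannel2 W1)
    (hW2 : IsChannel3 W2) : 0 ≤ IK1 P W1 + IK2 P W1 W2 := by
  rw [ks_IK_eq hP0 hW1 hW2]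
  have hS := ks_sub hP0 hP1 hW1 hW2
  have key : ∑ x, ∑ y, ∑ a, ∑ b, (P x y * (W1 x y a * W2 x y a b) - P x y * ksS P W1 W2 y a b) ≤
      ksJ P (fun x y a b => W1 x y a * W2 x y a b) (ksS P W1 W2) := by
    unfold ksJ
    refine Finset.sum_le_sum fun x _ => Finset.sum_le_sum fun y _ => Finset.sum_le_sum fun a _ =>
      Finset.sum_le_sum fun b _ => ?_
    rcases (hP0 x y).eq_or_lt with h | h
    · simp [← h]
    · have := ks_base (mul_nonneg ((hW1 x y).1 a) ((hW2 x y a).1 b)) (hS.1 y a b)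
        (ks_dom hP0 hW1 hW2 x y a b h) one_pos
      rw [Real.log_one] at this
      rw [← mul_sub]
      exact mul_le_mul_of_nonneg_left (by linarith) h.le
  simp only [Finset.sum_sub_distrib] at key
  rw [ks_V_sum hP1 hW1 hW2] at key
  have : ∑ x, ∑ y, ∑ a, ∑ b, P x y * ksS P W1 W2 y a b ≤ 1 := by
    rw [← hP1]
    refine Finset.sum_le_sum fun x _ => Finset.sum_le_sum fun y _ => ?_
    simp only [← Finset.mul_sum]
    exact mul_le_of_le_one_right (hP0 x y) (ks_S_sum hS y)
  linarith

lemma ks_IK_le (hP0 : ∀ x y, 0 ≤ P x y) (hP1 : ∑ x, ∑ y, P x y = 1) (hW1 : IsChannel2 W1)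
    (hW2 : IsChannel3 W2) {S : 𝒴 → A → B → ℝ} (hS : ksSub S)
    (hd : ∀ x y a b, 0 < P x y → S y a b = 0 → W1 x y a * W2 x y a b = 0) :
    IK1 P W1 + IK2 P W1 W2 ≤ ksJ P (fun x y a b => W1 x y a * W2 x y a b) S := by
  rw [ks_IK_eq hP0 hW1 hW2]
  have hSs := ks_sub hP0 hP1 hW1 hW2
  have hV0 : ∀ x y a b, 0 ≤ W1 x y a * W2 x y a b := fun x y a b =>
    mul_nonneg ((hW1 x y).1 a) ((hW2 x y a).1 b)
  have key : ksJ P (fun x y a b => W1 x y a * W2 x y a b) (ksS P W1 W2) +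
      ∑ x, ∑ y, ∑ a, ∑ b, (P x y * (W1 x y a * W2 x y a b) -
        P x y * (W1 x y a * W2 x y a b) * (S y a b / ksS P W1 W2 y a b)) ≤
      ksJ P (fun x y a b => W1 x y a * W2 x y a b) S := by
    unfold ksJ
    simp only [← Finset.sum_add_distrib]
    refine Finset.sum_le_sum fun x _ => Finset.sum_le_sum fun y _ => Finset.sum_le_sum fun a _ =>
      Finset.sum_le_sum fun b _ => ?_
    rcases (hP0 x y).eq_or_lt with h | h
    · simp [← h]
    rcases (hV0 x y a b).eq_or_lt with h1 | h1
    · simp [← h1]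
    have hs : 0 < ksS P W1 W2 y a b := lt_of_le_of_ne (hSs.1 y a b)
      (fun e => h1.ne' (ks_dom hP0 hW1 hW2 x y a b h e.symm))
    have := mul_le_mul_of_nonneg_left (ks_base h1.le (hS.1 y a b) (hd x y a b h)
      (div_pos h1 hs)) h.le
    refine le_trans (le_of_eq ?_) this
    ring
  simp only [Finset.sum_sub_distrib] at key
  rw [ks_V_sum hP1 hW1 hW2] at key
  have : ∑ x, ∑ y, ∑ a, ∑ b, P x y * (W1 x y a * W2 x y a b) * (S y a b / ksS P W1 W2 y a b)
      ≤ 1 := by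
    obtain ⟨hS0, q, hq, hqS⟩ := hS
    have hPW : ∀ y a, 0 ≤ ∑ x, P x y * W1 x y a := fun y a =>
      Finset.sum_nonneg fun x _ => mul_nonneg (hP0 x y) ((hW1 x y).1 a)
    calc _ = ∑ a, ∑ y, ∑ b, ∑ x,
          P x y * (W1 x y a * W2 x y a b) * (S y a b / ksS P W1 W2 y a b) := by
          rw [Finset.sum_comm]
          rw [Finset.sum_comm (s := (Finset.univ : Finset A))]
          refine Finset.sum_congr rfl fun y _ => ?_
          rw [Finset.sum_comm]
          refine Finset.sum_congr rfl fun a _ => ?_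
          rw [Finset.sum_comm]
      _ ≤ ∑ a, ∑ y, ∑ b, S y a b * ((∑ x, P x y * W1 x y a) / PA P W1 a) := by
          refine Finset.sum_le_sum fun a _ => Finset.sum_le_sum fun y _ =>
            Finset.sum_le_sum fun b _ => ?_
          rw [← Finset.sum_mul]
          have e : ∑ x, P x y * (W1 x y a * W2 x y a b) = ∑ x, P x y * W1 x y a * W2 x y a b := by
            simp only [mul_assoc]
          rw [e]
          unfold ksS PBgYA
          by_cases h0 : ∑ x, P x y * W1 x y a * W2 x y a b = 0
          · rw [h0, zero_mul]
            exact mul_nonneg (hS0 y a b) (div_nonneg (hPW y a) (ks_PA_nonneg hP0 hW1 a))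
          · apply le_of_eq
            rw [div_eq_mul_inv, mul_inv, inv_div]
            field_simp
      _ ≤ ∑ a, q a := by
          refine Finset.sum_le_sum fun a _ => ?_
          by_cases hA : Nonempty 𝒴
          swap
          · exfalso
            rw [not_nonempty_iff] at hA
            simp at hP1
          obtain ⟨y0⟩ := hA
          have hqa : 0 ≤ q a := (Finset.sum_nonneg fun b _ => hS0 y0 a b).trans (hqS y0 a)
          calc _ ≤ ∑ y, q a * ((∑ x, P x y * W1 x y a) / PA P W1 a) := by
                refine Finset.sum_le_sum fun y _ => ?_
                rw [← Finset.sum_mul]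
                exact mul_le_mul_of_nonneg_right (hqS y a)
                  (div_nonneg (hPW y a) (ks_PA_nonneg hP0 hW1 a))
            _ = q a * (PA P W1 a / PA P W1 a) := by
                rw [← Finset.mul_sum, ← Finset.sum_div, Finset.sum_comm]; rfl
            _ ≤ q a := mul_le_of_le_one_right hqa (div_self_le_one _)
      _ ≤ 1 := hq
  linarith

lemma ks_RK_le (hP0 : ∀ x y, 0 ≤ P x y) (hP1 : ∑ x, ∑ y, P x y = 1) (hW2 : IsChannel3 W2)
    {d1 : 𝒳 → A → ℝ} {d2 : 𝒳 → B → ℝ} {D1 D2 : ℝ}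
    {S : 𝒴 → A → B → ℝ} (hS : ksSub S) {V : 𝒳 → 𝒴 → A → B → ℝ} (hV0 : ∀ x y a b, 0 ≤ V x y a b)
    (hV1 : ∀ x y, ∑ a, ∑ b, V x y a b = 1)
    (hd : ∀ x y a b, 0 < P x y → S y a b = 0 → V x y a b = 0)
    (h1 : ∑ x, ∑ y, ∑ a, ∑ b, P x y * V x y a b * d1 x a ≤ D1)
    (h2 : ∑ x, ∑ y, ∑ a, ∑ b, P x y * V x y a b * d2 x b ≤ D2) :
    RK P d1 d2 D1 D2 ≤ ksJ P V S := by
  obtain ⟨U1, U2, hU1, hU2, hU⟩ := ks_factor V hV0 hV1 W2 hW2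
  have e : (fun x y a b => U1 x y a * U2 x y a b) = V := by
    funext x y a b; exact hU x y a b
  have hle := ks_IK_le hP0 hP1 hU1 hU2 hS (by intro x y a b h h'; rw [hU]; exact hd x y a b h h')
  rw [e] at hle
  refine le_trans ?_ hle
  refine csInf_le ⟨0, ?_⟩ ⟨U1, U2, hU1, hU2, ?_, ?_, rfl⟩
  · rintro r ⟨T1, T2, hT1, hT2, _, _, rfl⟩
    exact ks_IK_nonneg hP0 hP1 hT1 hT2
  · refine le_trans (le_of_eq ?_) h1
    refine Finset.sum_congr rfl fun x _ => Finset.sum_congr rfl fun y _ =>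
      Finset.sum_congr rfl fun a _ => ?_
    simp only [← hU]
    rw [← Finset.sum_mul, ← Finset.mul_sum, ← Finset.mul_sum, (hU2 x y a).2, mul_one]
  · refine le_trans (le_of_eq ?_) h2
    simp only [← hU, mul_assoc]

lemma ks_mix_sub {S S' : 𝒴 → A → B → ℝ} (hS : ksSub S) (hS' : ksSub S') {t : ℝ} (ht0 : 0 < t)
    (ht1 : t < 1) : ksSub (fun y a b => (1 - t) * S y a b + t * S' y a b) := by
  obtain ⟨h0, q, hq, h⟩ := hS
  obtain ⟨h0', q', hq', h'⟩ := hS'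
  have hs : 0 ≤ 1 - t := by linarith
  refine ⟨fun y a b => add_nonneg (mul_nonneg hs (h0 y a b)) (mul_nonneg ht0.le (h0' y a b)),
    fun a => (1 - t) * q a + t * q' a, ?_, ?_⟩
  · rw [Finset.sum_add_distrib, ← Finset.mul_sum, ← Finset.mul_sum]
    nlinarith
  · intro y a
    rw [Finset.sum_add_distrib, ← Finset.mul_sum, ← Finset.mul_sum]
    exact add_le_add (mul_le_mul_of_nonneg_left (h y a) hs)
      (mul_le_mul_of_nonneg_left (h' y a) ht0.le)

lemma ks_lin {V V' : 𝒳 → 𝒴 → A → B → ℝ} (d : 𝒳 → A → B → ℝ) (t : ℝ) :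
    ∑ x, ∑ y, ∑ a, ∑ b, P x y * ((1 - t) * V x y a b + t * V' x y a b) * d x a b =
    (1 - t) * ∑ x, ∑ y, ∑ a, ∑ b, P x y * V x y a b * d x a b +
      t * ∑ x, ∑ y, ∑ a, ∑ b, P x y * V' x y a b * d x a b := by
  simp only [Finset.mul_sum, ← Finset.sum_add_distrib]
  refine Finset.sum_congr rfl fun x _ => Finset.sum_congr rfl fun y _ =>
    Finset.sum_congr rfl fun a _ => Finset.sum_congr rfl fun b _ => ?_
  ring

lemma ks_lagr (hP0 : ∀ x y, 0 ≤ P x y) (hP1 : ∑ x, ∑ y, P x y = 1)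
    (hW1 : IsChannel2 W1) (hW2 : IsChannel3 W2)
    {d1 : 𝒳 → A → ℝ} {d2 : 𝒳 → B → ℝ} {D1 D2 : ℝ}
    (hreg : DifferentiableAt ℝ
      (fun q : (𝒳 → 𝒴 → ℝ) × ℝ × ℝ => RK q.1 d1 d2 q.2.1 q.2.2) (P, D1, D2))
    (hWd1 : (∑ x, ∑ y, ∑ a, ∑ b, P x y * (W1 x y a * W2 x y a b) * d1 x a) ≤ D1)
    (hWd2 : (∑ x, ∑ y, ∑ a, ∑ b, P x y * (W1 x y a * W2 x y a b) * d2 x b) ≤ D2)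
    (hWopt : IK1 P W1 + IK2 P W1 W2 = RK P d1 d2 D1 D2)
    {lam1 : ℝ} (hlam1 : HasDerivAt (fun D => RK P d1 d2 D D2) (-lam1) D1)
    {lam2 : ℝ} (hlam2 : HasDerivAt (fun D => RK P d1 d2 D1 D) (-lam2) D2)
    {S : 𝒴 → A → B → ℝ} (hS : ksSub S) {V : 𝒳 → 𝒴 → A → B → ℝ} (hV0 : ∀ x y a b, 0 ≤ V x y a b)
    (hV1 : ∀ x y, ∑ a, ∑ b, V x y a b = 1)
    (hd : ∀ x y a b, 0 < P x y → S y a b = 0 → V x y a b = 0) :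
    RK P d1 d2 D1 D2 + lam1 * D1 + lam2 * D2 ≤ ksJ P V S +
      lam1 * (∑ x, ∑ y, ∑ a, ∑ b, P x y * V x y a b * d1 x a) +
      lam2 * (∑ x, ∑ y, ∑ a, ∑ b, P x y * V x y a b * d2 x b) := by
  obtain ⟨L, hL⟩ := hreg
  set E1 := ∑ x, ∑ y, ∑ a, ∑ b, P x y * V x y a b * d1 x a with hE1
  set E2 := ∑ x, ∑ y, ∑ a, ∑ b, P x y * V x y a b * d2 x b with hE2
  have hL1 : L (0, 1, 0) = -lam1 := by
    have hc : HasDerivAt (fun D : ℝ => ((P, D, D2) : (𝒳 → 𝒴 → ℝ) × ℝ × ℝ)) (0, 1, 0) D1 :=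
      (hasDerivAt_const D1 P).prodMk ((hasDerivAt_id D1).prodMk (hasDerivAt_const D1 D2))
    have hh := HasFDerivAt.comp_hasDerivAt D1 hL hc
    exact hh.unique hlam1
  have hL2 : L (0, 0, 1) = -lam2 := by
    have hc : HasDerivAt (fun D : ℝ => ((P, D1, D) : (𝒳 → 𝒴 → ℝ) × ℝ × ℝ)) (0, 0, 1) D2 :=
      (hasDerivAt_const D2 P).prodMk ((hasDerivAt_const D2 D1).prodMk (hasDerivAt_id D2))
    have hh := HasFDerivAt.comp_hasDerivAt D2 hL hc
    exact hh.unique hlam2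
  have hLe : L (0, E1 - D1, E2 - D2) = -lam1 * (E1 - D1) + -lam2 * (E2 - D2) := by
    have : ((0, E1 - D1, E2 - D2) : (𝒳 → 𝒴 → ℝ) × ℝ × ℝ) =
        (E1 - D1) • (0, 1, 0) + (E2 - D2) • (0, 0, 1) := by
      ext <;> simp
    rw [this, map_add, map_smul, map_smul, hL1, hL2, smul_eq_mul, smul_eq_mul]
    ring
  have hg : HasDerivAt (fun t : ℝ => RK P d1 d2 (D1 + t * (E1 - D1)) (D2 + t * (E2 - D2)))
      (-lam1 * (E1 - D1) + -lam2 * (E2 - D2)) 0 := by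
    rw [← hLe]
    have hc : HasDerivAt (fun t : ℝ => ((P, D1 + t * (E1 - D1), D2 + t * (E2 - D2)) :
        (𝒳 → 𝒴 → ℝ) × ℝ × ℝ)) (0, E1 - D1, E2 - D2) 0 := by
      refine (hasDerivAt_const _ P).prodMk (HasDerivAt.prodMk ?_ ?_)
      · simpa using ((hasDerivAt_id (0:ℝ)).mul_const (E1 - D1)).const_add D1
      · simpa using ((hasDerivAt_id (0:ℝ)).mul_const (E2 - D2)).const_add D2
    have hL' : HasFDerivAt (fun q : (𝒳 → 𝒴 → ℝ) × ℝ × ℝ => RK q.1 d1 d2 q.2.1 q.2.2) L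
        (P, D1 + 0 * (E1 - D1), D2 + 0 * (E2 - D2)) := by simpa using hL
    exact hL'.comp_hasDerivAt (0:ℝ) hc
  have := ks_deriv_le (c := ksJ P V S - RK P d1 d2 D1 D2) hg ?_
  · linarith
  intro t ht0 ht1
  simp only [zero_mul, add_zero]
  have hs : 0 < 1 - t := by linarith
  have hSs := ks_sub hP0 hP1 hW1 hW2
  have hdom := ks_dom hP0 hW1 hW2
  have hVs0 : ∀ x y a b, 0 ≤ W1 x y a * W2 x y a b := fun x y a b =>
    mul_nonneg ((hW1 x y).1 a) ((hW2 x y a).1 b)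
  have hR : RK P d1 d2 (D1 + t * (E1 - D1)) (D2 + t * (E2 - D2)) ≤
      ksJ P (fun x y a b => (1 - t) * (W1 x y a * W2 x y a b) + t * V x y a b)
        (fun y a b => (1 - t) * ksS P W1 W2 y a b + t * S y a b) := by
    refine ks_RK_le hP0 hP1 hW2 (ks_mix_sub hSs hS ht0 ht1) ?_ ?_ ?_ ?_ ?_
    · intro x y a b
      exact add_nonneg (mul_nonneg hs.le (hVs0 x y a b)) (mul_nonneg ht0.le (hV0 x y a b))
    · intro x y
      simp only [Finset.sum_add_distrib, ← Finset.mul_sum, hV1, (hW2 x y _).2, mul_one, (hW1 x y).2]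
      ring
    · intro x y a b hP h
      have a1 := mul_nonneg hs.le (hSs.1 y a b)
      have a2 := mul_nonneg ht0.le (hS.1 y a b)
      have b1 : (1 - t) * ksS P W1 W2 y a b = 0 := by linarith
      have b2 : t * S y a b = 0 := by linarith
      rw [hdom x y a b hP ((mul_eq_zero.1 b1).resolve_left hs.ne'),
        hd x y a b hP ((mul_eq_zero.1 b2).resolve_left ht0.ne')]
      ring
    · rw [ks_lin (fun x a _ => d1 x a), ← hE1]
      nlinarith
    · rw [ks_lin (fun x _ b => d2 x b), ← hE2]
      nlinarith
  have hJ : ksJ P (fun x y a b => (1 - t) * (W1 x y a * W2 x y a b) + t * V x y a b)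
        (fun y a b => (1 - t) * ksS P W1 W2 y a b + t * S y a b) ≤
      (1 - t) * ksJ P (fun x y a b => W1 x y a * W2 x y a b) (ksS P W1 W2) + t * ksJ P V S := by
    unfold ksJ
    simp only [Finset.mul_sum, ← Finset.sum_add_distrib]
    refine Finset.sum_le_sum fun x _ => Finset.sum_le_sum fun y _ =>
      Finset.sum_le_sum fun a _ => Finset.sum_le_sum fun b _ => ?_
    rcases (hP0 x y).eq_or_lt with h | h
    · simp [← h]
    · have := mul_le_mul_of_nonneg_left (ks_mix (hVs0 x y a b) (hV0 x y a b) (hSs.1 y a b)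
        (hS.1 y a b) (hdom x y a b h) (hd x y a b h) ht0 ht1) h.le
      refine this.trans (le_of_eq ?_)
      ring
  rw [← ks_IK_eq hP0 hW1 hW2, hWopt] at hJ
  linarith

/-- Normalising function of a kernel. -/
def ksZ (c : 𝒳 → A → B → ℝ) (S : 𝒴 → A → B → ℝ) (x : 𝒳) (y : 𝒴) : ℝ :=
  ∑ a, ∑ b, S y a b * Real.exp (-c x a b)

lemma ks_Z_nonneg (c : 𝒳 → A → B → ℝ) {S : 𝒴 → A → B → ℝ} (hS : ∀ y a b, 0 ≤ S y a b) (x y) :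
    0 ≤ ksZ c S x y :=
  Finset.sum_nonneg fun a _ => Finset.sum_nonneg fun b _ =>
    mul_nonneg (hS y a b) (Real.exp_pos _).le

lemma ks_Z_pos (c : 𝒳 → A → B → ℝ) (hP0 : ∀ x y, 0 ≤ P x y) (hP1 : ∑ x, ∑ y, P x y = 1)
    (hW1 : IsChannel2 W1) (hW2 : IsChannel3 W2) (x y) (h : 0 < P x y) :
    0 < ksZ c (ksS P W1 W2) x y := by
  have hS := (ks_sub hP0 hP1 hW1 hW2).1
  refine lt_of_le_of_ne (ks_Z_nonneg c hS x y) (fun e => ?_)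
  have e0 : ∀ a b, ksS P W1 W2 y a b = 0 := by
    intro a b
    have e1 := (Finset.sum_eq_zero_iff_of_nonneg (fun a _ => Finset.sum_nonneg fun b _ =>
      mul_nonneg (hS y a b) (Real.exp_pos (-c x a b)).le)).1 e.symm a (Finset.mem_univ _)
    have e2 := (Finset.sum_eq_zero_iff_of_nonneg (fun b _ =>
      mul_nonneg (hS y a b) (Real.exp_pos (-c x a b)).le)).1 e1 b (Finset.mem_univ _)
    exact (mul_eq_zero.1 e2).resolve_right (Real.exp_pos _).ne'
  have e3 : ∑ a, ∑ b, W1 x y a * W2 x y a b = 0 :=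
    Finset.sum_eq_zero fun a _ => Finset.sum_eq_zero fun b _ =>
      ks_dom hP0 hW1 hW2 x y a b h (e0 a b)
  simp only [← Finset.mul_sum, (hW2 x y _).2, mul_one, (hW1 x y).2] at e3
  exact one_ne_zero e3

/-- Donsker–Varadhan direction. -/
lemma ks_DV (c : 𝒳 → A → B → ℝ) (hP0 : ∀ x y, 0 ≤ P x y) {S : 𝒴 → A → B → ℝ}
    (hS : ∀ y a b, 0 ≤ S y a b)
    (hZ : ∀ x y, 0 < P x y → 0 < ksZ c S x y)
    {V : 𝒳 → 𝒴 → A → B → ℝ} (hV0 : ∀ x y a b, 0 ≤ V x y a b)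
    (hV1 : ∀ x y, ∑ a, ∑ b, V x y a b = 1)
    (hd : ∀ x y a b, 0 < P x y → S y a b = 0 → V x y a b = 0) :
    ∑ x, ∑ y, P x y * (-Real.log (ksZ c S x y)) ≤ ksJ P V S +
      ∑ x, ∑ y, ∑ a, ∑ b, P x y * V x y a b * c x a b := by
  unfold ksJ
  simp only [← Finset.sum_add_distrib]
  refine Finset.sum_le_sum fun x _ => Finset.sum_le_sum fun y _ => ?_
  rcases (hP0 x y).eq_or_lt with h | h
  · simp [← h]
  have hz := hZ x y h
  have key : ∑ a, ∑ b, P x y * (V x y a b * (1 - Real.log (ksZ c S x y)) -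
      S y a b * Real.exp (-c x a b) / ksZ c S x y) ≤
      ∑ a, ∑ b, (P x y * (V x y a b * Real.log (V x y a b / S y a b)) +
        P x y * V x y a b * c x a b) := by
    refine Finset.sum_le_sum fun a _ => Finset.sum_le_sum fun b _ => ?_
    have := mul_le_mul_of_nonneg_left (ks_base (hV0 x y a b) (hS y a b) (hd x y a b h)
      (div_pos (Real.exp_pos (-c x a b)) hz)) h.le
    rw [Real.log_div (Real.exp_pos _).ne' hz.ne', Real.log_exp] at this
    have e : S y a b * (Real.exp (-c x a b) / ksZ c S x y) =
      S y a b * Real.exp (-c x a b) / ksZ c S x y := by ring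
    rw [e] at this
    linarith
  refine le_trans (le_of_eq ?_) key
  simp only [← Finset.mul_sum, Finset.sum_sub_distrib, ← Finset.sum_mul, ← Finset.sum_div, hV1]
  have : ∑ a, ∑ b, S y a b * Real.exp (-c x a b) = ksZ c S x y := rfl
  rw [this, div_self hz.ne']
  ring

/-- The tilted channel attains the bound. -/
lemma ks_tilt (c : 𝒳 → A → B → ℝ) (hP0 : ∀ x y, 0 ≤ P x y) 
    (hW1 : IsChannel2 W1) (hW2 : IsChannel3 W2) {S : 𝒴 → A → B → ℝ}
    (hS : ∀ y a b, 0 ≤ S y a b)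
    (hZ : ∀ x y, 0 < P x y → 0 < ksZ c S x y) :
    ∃ V : 𝒳 → 𝒴 → A → B → ℝ, (∀ x y a b, 0 ≤ V x y a b) ∧ (∀ x y, ∑ a, ∑ b, V x y a b = 1) ∧
      (∀ x y a b, 0 < P x y → S y a b = 0 → V x y a b = 0) ∧
      ksJ P V S + ∑ x, ∑ y, ∑ a, ∑ b, P x y * V x y a b * c x a b =
        ∑ x, ∑ y, P x y * (-Real.log (ksZ c S x y)) := by
  classical
  have hV1 : ∀ x y, ∑ a, ∑ b, (if 0 < P x y then S y a b * Real.exp (-c x a b) / ksZ c S x y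
      else W1 x y a * W2 x y a b) = 1 := by
    intro x y
    by_cases h : 0 < P x y
    · simp only [h, if_true, ← Finset.sum_div]
      exact div_self (hZ x y h).ne'
    · simp only [h, if_false, ← Finset.mul_sum, (hW2 x y _).2, mul_one, (hW1 x y).2]
  refine ⟨fun x y a b => if 0 < P x y then S y a b * Real.exp (-c x a b) / ksZ c S x y
      else W1 x y a * W2 x y a b, ?_, hV1, ?_, ?_⟩
  · intro x y a b
    by_cases h : 0 < P x y
    · simp only [h, if_true]
      exact div_nonneg (mul_nonneg (hS y a b) (Real.exp_pos _).le) (hZ x y h).le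
    · simp only [h, if_false]
      exact mul_nonneg ((hW1 x y).1 a) ((hW2 x y a).1 b)
  · intro x y a b h h'
    simp [h, h']
  · unfold ksJ
    simp only [← Finset.sum_add_distrib]
    refine Finset.sum_congr rfl fun x _ => Finset.sum_congr rfl fun y _ => ?_
    rcases (hP0 x y).eq_or_lt with h | h
    · simp [← h]
    have hz := hZ x y h
    have h1 := hV1 x y
    simp only [h, if_true] at h1 ⊢
    rw [← one_mul (Real.log _), ← mul_neg, ← h1]
    simp only [Finset.sum_mul, Finset.mul_sum]
    refine Finset.sum_congr rfl fun a _ => Finset.sum_congr rfl fun b _ => ?_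
    rcases (hS y a b).eq_or_lt with h0 | h0
    · simp [← h0]
    have : S y a b * Real.exp (-c x a b) / ksZ c S x y / S y a b =
      Real.exp (-c x a b) / ksZ c S x y := by field_simp
    rw [this, Real.log_div (Real.exp_pos _).ne' hz.ne', Real.log_exp]
    ring

lemma ks_single (hP0 : ∀ x y, 0 ≤ P x y) (hP1 : ∑ x, ∑ y, P x y = 1)
    (hW1 : IsChannel2 W1) (hW2 : IsChannel3 W2)
    {d1 : 𝒳 → A → ℝ} {d2 : 𝒳 → B → ℝ} {D1 D2 : ℝ}
    (hreg : DifferentiableAt ℝ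
      (fun q : (𝒳 → 𝒴 → ℝ) × ℝ × ℝ => RK q.1 d1 d2 q.2.1 q.2.2) (P, D1, D2))
    (hWd1 : (∑ x, ∑ y, ∑ a, ∑ b, P x y * (W1 x y a * W2 x y a b) * d1 x a) ≤ D1)
    (hWd2 : (∑ x, ∑ y, ∑ a, ∑ b, P x y * (W1 x y a * W2 x y a b) * d2 x b) ≤ D2)
    (hWopt : IK1 P W1 + IK2 P W1 W2 = RK P d1 d2 D1 D2)
    {lam1 : ℝ} (hlam1 : HasDerivAt (fun D => RK P d1 d2 D D2) (-lam1) D1) (hlam10 : 0 ≤ lam1)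
    {lam2 : ℝ} (hlam2 : HasDerivAt (fun D => RK P d1 d2 D1 D) (-lam2) D2) (hlam20 : 0 ≤ lam2)
    {c : 𝒳 → A → B → ℝ} (hc : ∀ x a b, c x a b = lam1 * d1 x a + lam2 * d2 x b)
    (a0 : A) (b0 : 𝒴 → B) :
    ∑ x, ∑ y, P x y * (Real.exp (-c x a0 (b0 y)) / ksZ c (ksS P W1 W2) x y) ≤ 1 := by
  classical
  set Ss := ksS P W1 W2 with hSs_def
  have hSs : ksSub Ss := ks_sub hP0 hP1 hW1 hW2
  have hZs : ∀ x y, 0 < P x y → 0 < ksZ c Ss x y := ks_Z_pos c hP0 hP1 hW1 hW2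
  have hcost : ∀ V : 𝒳 → 𝒴 → A → B → ℝ,
      ∑ x, ∑ y, ∑ a, ∑ b, P x y * V x y a b * c x a b =
      lam1 * (∑ x, ∑ y, ∑ a, ∑ b, P x y * V x y a b * d1 x a) +
      lam2 * (∑ x, ∑ y, ∑ a, ∑ b, P x y * V x y a b * d2 x b) := by
    intro V
    simp only [Finset.mul_sum, ← Finset.sum_add_distrib, hc]
    refine Finset.sum_congr rfl fun x _ => Finset.sum_congr rfl fun y _ =>
      Finset.sum_congr rfl fun a _ => Finset.sum_congr rfl fun b _ => ?_
    ring
  -- upper bound at the optimum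
  have hup : ∑ x, ∑ y, P x y * (-Real.log (ksZ c Ss x y)) ≤
      RK P d1 d2 D1 D2 + lam1 * D1 + lam2 * D2 := by
    have := ks_DV c hP0 hSs.1 hZs (V := fun x y a b => W1 x y a * W2 x y a b)
      (fun x y a b => mul_nonneg ((hW1 x y).1 a) ((hW2 x y a).1 b))
      (fun x y => by simp only [← Finset.mul_sum, (hW2 x y _).2, mul_one, (hW1 x y).2])
      (ks_dom hP0 hW1 hW2)
    rw [← ks_IK_eq hP0 hW1 hW2, hWopt, hcost] at this
    have := mul_le_mul_of_nonneg_left hWd1 hlam10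
    have := mul_le_mul_of_nonneg_left hWd2 hlam20
    linarith
  let S : 𝒴 → A → B → ℝ := fun y a b => if a = a0 then (if b = b0 y then 1 else 0) else 0
  have hS : ksSub S := by
    refine ⟨fun y a b => ?_, fun a => if a = a0 then 1 else 0, by simp, fun y a => ?_⟩
    · simp only [S]; split_ifs <;> norm_num
    · simp only [S]; by_cases h : a = a0 <;> simp [h]
  have hZS : ∀ x y, ksZ c S x y = Real.exp (-c x a0 (b0 y)) := by
    intro x y
    unfold ksZ
    rw [Finset.sum_eq_single a0, Finset.sum_eq_single (b0 y)]
    · simp [S]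
    · intro b _ hb; simp [S, hb]
    · simp
    · intro a _ ha; simp [S, ha]
    · simp
  have hlow : ∀ t : ℝ, 0 < t → t < 1 →
      RK P d1 d2 D1 D2 + lam1 * D1 + lam2 * D2 ≤
      ∑ x, ∑ y, P x y *
        (-Real.log ((1 - t) * ksZ c Ss x y + t * Real.exp (-c x a0 (b0 y)))) := by
    intro t ht0 ht1
    have hs : 0 < 1 - t := by linarith
    have hSt := ks_mix_sub hSs hS ht0 ht1
    have hZt : ∀ x y, ksZ c (fun y a b => (1 - t) * Ss y a b + t * S y a b) x y =
        (1 - t) * ksZ c Ss x y + t * Real.exp (-c x a0 (b0 y)) := by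
      intro x y
      rw [← hZS]
      unfold ksZ
      simp only [Finset.mul_sum, ← Finset.sum_add_distrib]
      refine Finset.sum_congr rfl fun a _ => Finset.sum_congr rfl fun b _ => ?_
      ring
    obtain ⟨V, hV0, hV1, hd, hV⟩ := ks_tilt (P := P) c hP0 hW1 hW2 hSt.1 (by
      intro x y h
      rw [hZt]
      have := mul_pos hs (hZs x y h)
      positivity)
    have := ks_lagr hP0 hP1 hW1 hW2 hreg hWd1 hWd2 hWopt hlam1 hlam2 hSt hV0 hV1 hd
    rw [add_assoc (ksJ _ _ _), ← hcost, hV] at this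
    simpa only [hZt] using this
  have hder : HasDerivAt (fun t : ℝ => ∑ x, ∑ y, P x y *
        Real.log ((1 - t) * ksZ c Ss x y + t * Real.exp (-c x a0 (b0 y))))
      (∑ x, ∑ y, P x y * (Real.exp (-c x a0 (b0 y)) / ksZ c Ss x y - 1)) 0 := by
    refine HasDerivAt.fun_sum fun x _ => HasDerivAt.fun_sum fun y _ => ?_
    rcases (hP0 x y).eq_or_lt with h | h
    · simp only [← h, zero_mul]
      exact hasDerivAt_const _ _
    have hz := hZs x y h
    refine HasDerivAt.const_mul _ ?_
    have h1 : HasDerivAt (fun t : ℝ => (1 - t) * ksZ c Ss x y + t * Real.exp (-c x a0 (b0 y)))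
        (-1 * ksZ c Ss x y + 1 * Real.exp (-c x a0 (b0 y))) 0 :=
      (((hasDerivAt_id (0:ℝ)).const_sub 1).mul_const _).add ((hasDerivAt_id (0:ℝ)).mul_const _)
    have h2 := h1.log (by simpa using hz.ne')
    have h3 : (-1 * ksZ c Ss x y + 1 * Real.exp (-c x a0 (b0 y))) /
        ((1 - 0) * ksZ c Ss x y + 0 * Real.exp (-c x a0 (b0 y))) =
        Real.exp (-c x a0 (b0 y)) / ksZ c Ss x y - 1 := by
      rw [sub_zero, one_mul, one_mul, zero_mul, add_zero]
      field_simp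
      ring
    rw [h3] at h2
    exact h2
  have hle := ks_deriv_le (c := 0) hder (by
    intro t ht0 ht1
    have h1 := hlow t ht0 ht1
    have h2 := hup.trans h1
    simp only [mul_neg, Finset.sum_neg_distrib] at h2
    simp only [sub_zero, one_mul, zero_mul, add_zero, mul_zero]
    linarith)
  simp only [mul_sub, Finset.sum_sub_distrib, mul_one] at hle
  linarith

/-- Multi-letter bound from the single-letter one. -/
lemma ks_multi (K : 𝒳 → 𝒴 → A → B → ℝ) (hK0 : ∀ x y a b, 0 ≤ K x y a b) [Nonempty B]
    (hK : ∀ (a : A) (b : 𝒴 → B), ∑ x, ∑ y, K x y a (b y) ≤ 1) (n : ℕ)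
    (as : Fin n → A) (bs : (Fin n → 𝒴) → Fin n → B) :
    ∑ p : (Fin n → 𝒳) × (Fin n → 𝒴), ∏ i, K (p.1 i) (p.2 i) (as i) (bs p.2 i) ≤ 1 := by
  classical
  have hmax : ∀ y a, ∃ b, ∀ b', ∑ x, K x y a b' ≤ ∑ x, K x y a b := fun y a =>
    Finite.exists_max fun b => ∑ x, K x y a b
  choose β hβ using hmax
  rw [Fintype.sum_prod_type, Finset.sum_comm]
  calc _ = ∑ ys : Fin n → 𝒴, ∏ i, ∑ x, K x (ys i) (as i) (bs ys i) := by
        refine Finset.sum_congr rfl fun ys _ => ?_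
        rw [Finset.prod_univ_sum, Fintype.piFinset_univ]
    _ ≤ ∑ ys : Fin n → 𝒴, ∏ i, ∑ x, K x (ys i) (as i) (β (ys i) (as i)) := by
        refine Finset.sum_le_sum fun ys _ => Finset.prod_le_prod (fun i _ => ?_) (fun i _ => ?_)
        · exact Finset.sum_nonneg fun x _ => hK0 _ _ _ _
        · exact hβ _ _ _
    _ = ∏ i, ∑ y, ∑ x, K x y (as i) (β y (as i)) := by
        rw [Finset.prod_univ_sum, Fintype.piFinset_univ]
    _ ≤ 1 := by
        refine Finset.prod_le_one (fun i _ => Finset.sum_nonneg fun y _ =>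
          Finset.sum_nonneg fun x _ => hK0 _ _ _ _) (fun i _ => ?_)
        rw [Finset.sum_comm]
        exact hK (as i) (fun y => β y (as i))

end KS

/-- **Finite-blocklength converse bound for the Kaspi problem.**  Under the regularity
assumptions (optimal test channels achieving `R(P_{XY},D₁,D₂)` and derivatives
`λᵢ = −∂R/∂Dᵢ ≥ 0`), every `(n,M)`-code satisfies
`P_{e,n}(D₁,D₂) ≥ Pr{∑ᵢ ȷ_K(Xᵢ,Yᵢ) ≥ log M + nγ} − exp(−nγ)`. -/
theorem kaspi_converse
    {𝒳 𝒴 A B : Type} [Fintype 𝒳] [Fintype 𝒴] [Fintype A] [Fintype B]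
    (P : 𝒳 → 𝒴 → ℝ) (hP0 : ∀ x y, 0 ≤ P x y) (hP1 : ∑ x, ∑ y, P x y = 1)
    (d1 : 𝒳 → A → ℝ) (hd1 : ∀ x a, 0 ≤ d1 x a)
    (d2 : 𝒳 → B → ℝ) (hd2 : ∀ x b, 0 ≤ d2 x b)
    (D1 D2 : ℝ)
    (hreg : ContDiffAt ℝ 2
      (fun q : (𝒳 → 𝒴 → ℝ) × ℝ × ℝ => RK q.1 d1 d2 q.2.1 q.2.2) (P, D1, D2))
    (W1s : 𝒳 → 𝒴 → A → ℝ) (W2s : 𝒳 → 𝒴 → A → B → ℝ)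
    (hW1 : IsChannel2 W1s) (hW2 : IsChannel3 W2s)
    (hWd1 : (∑ x, ∑ y, ∑ a, P x y * W1s x y a * d1 x a) ≤ D1)
    (hWd2 : (∑ x, ∑ y, ∑ a, ∑ b, P x y * W1s x y a * W2s x y a b * d2 x b) ≤ D2)
    (hWopt : IK1 P W1s + IK2 P W1s W2s = RK P d1 d2 D1 D2)
    (lam1 : ℝ) (hlam1 : HasDerivAt (fun D => RK P d1 d2 D D2) (-lam1) D1)
    (hlam10 : 0 ≤ lam1)
    (lam2 : ℝ) (hlam2 : HasDerivAt (fun D => RK P d1 d2 D1 D) (-lam2) D2)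
    (hlam20 : 0 ≤ lam2)
    (n M : ℕ) (γ : ℝ) (hγ : 0 < γ)
    (f : ((Fin n → 𝒳) × (Fin n → 𝒴)) → Fin M)
    (φ1 : Fin M → (Fin n → A)) (φ2 : Fin M × (Fin n → 𝒴) → (Fin n → B)) :
    Pr (iidPairP P n)
        {p | Real.log M + n * γ ≤
          ∑ i, jKaspi P W1s W2s d1 d2 lam1 lam2 D1 D2 (p.1 i) (p.2 i)}
        - Real.exp (-(n * γ)) ≤
      Pr (iidPairP P n)
        {p | D1 < distn d1 p.1 (φ1 (f p)) ∨ D2 < distn d2 p.1 (φ2 (f p, p.2))} := by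
  classical
  have hne : ∃ x y, 0 < P x y := by
    by_contra hcon
    push Not at hcon
    have : ∑ x, ∑ y, P x y ≤ 0 :=
      Finset.sum_nonpos fun x _ => Finset.sum_nonpos fun y _ => hcon x y
    linarith
  obtain ⟨x0, y0, hxy0⟩ := hne
  have hA : Nonempty A := by
    by_contra h
    rw [not_nonempty_iff] at h
    have := (hW1 x0 y0).2
    simp at this
  have hB : Nonempty B := by
    by_contra h
    rw [not_nonempty_iff] at h
    have := (hW2 x0 y0 hA.some).2
    simp at this
  have hM : 0 < (M : ℝ) := by
    have := (f (fun _ => x0, fun _ => y0)).pos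
    exact_mod_cast this
  let c : 𝒳 → A → B → ℝ := fun x a b => lam1 * d1 x a + lam2 * d2 x b
  have hZ : ∀ x y, 0 < P x y → 0 < ksZ c (ksS P W1s W2s) x y := ks_Z_pos c hP0 hP1 hW1 hW2
  have hj : ∀ x y, jKaspi P W1s W2s d1 d2 lam1 lam2 D1 D2 x y =
      -Real.log (ksZ c (ksS P W1s W2s) x y) - lam1 * D1 - lam2 * D2 := by
    intro x y
    have : ksZ c (ksS P W1s W2s) x y = ∑ a, PA P W1s a * Real.exp (-(lam1 * d1 x a)) *
        (∑ b, PBgYA P W1s W2s y a b * Real.exp (-(lam2 * d2 x b))) := by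
      unfold ksZ ksS
      refine Finset.sum_congr rfl fun a _ => ?_
      rw [Finset.mul_sum]
      refine Finset.sum_congr rfl fun b _ => ?_
      simp only [c, neg_add, Real.exp_add]
      ring
    unfold jKaspi
    rw [this]
  have hWd1' : (∑ x, ∑ y, ∑ a, ∑ b, P x y * (W1s x y a * W2s x y a b) * d1 x a) ≤ D1 := by
    refine le_trans (le_of_eq ?_) hWd1
    refine Finset.sum_congr rfl fun x _ => Finset.sum_congr rfl fun y _ =>
      Finset.sum_congr rfl fun a _ => ?_
    rw [← Finset.sum_mul, ← Finset.mul_sum, ← Finset.mul_sum, (hW2 x y a).2, mul_one]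
  have hWd2' : (∑ x, ∑ y, ∑ a, ∑ b, P x y * (W1s x y a * W2s x y a b) * d2 x b) ≤ D2 := by
    refine le_trans (le_of_eq ?_) hWd2
    simp only [mul_assoc]
  have hsingle := ks_single hP0 hP1 hW1 hW2 (hreg.differentiableAt (by norm_num)) hWd1' hWd2' hWopt
    hlam1 hlam10 hlam2 hlam20 (c := c) (fun _ _ _ => rfl)
  let K : 𝒳 → 𝒴 → A → B → ℝ := fun x y a b =>
    P x y * (Real.exp (-c x a b) / ksZ c (ksS P W1s W2s) x y)
  have hK0 : ∀ x y a b, 0 ≤ K x y a b := by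
    intro x y a b
    exact mul_nonneg (hP0 x y) (div_nonneg (Real.exp_pos _).le
      (ks_Z_nonneg c (ks_sub hP0 hP1 hW1 hW2).1 x y))
  have hKeq : ∀ x y a b, K x y a b = P x y * Real.exp
      (jKaspi P W1s W2s d1 d2 lam1 lam2 D1 D2 x y + lam1 * (D1 - d1 x a)
        + lam2 * (D2 - d2 x b)) := by
    intro x y a b
    rcases (hP0 x y).eq_or_lt with h | h
    · simp [K, ← h]
    · have hz := hZ x y h
      simp only [K]
      rw [hj]
      congr 1
      have : -Real.log (ksZ c (ksS P W1s W2s) x y) - lam1 * D1 - lam2 * D2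
          + lam1 * (D1 - d1 x a) + lam2 * (D2 - d2 x b) =
          -c x a b - Real.log (ksZ c (ksS P W1s W2s) x y) := by
        simp only [c]; ring
      rw [this, Real.exp_sub, Real.exp_log hz]
  have hmulti : ∀ m : Fin M, ∑ p : (Fin n → 𝒳) × (Fin n → 𝒴),
      ∏ i, K (p.1 i) (p.2 i) (φ1 m i) (φ2 (m, p.2) i) ≤ 1 := fun m =>
    ks_multi K hK0 hsingle n (φ1 m) (fun ys => φ2 (m, ys))
  have hprod : ∀ (p : (Fin n → 𝒳) × (Fin n → 𝒴)) (as : Fin n → A) (bs : Fin n → B),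
      ∏ i, K (p.1 i) (p.2 i) (as i) (bs i) = iidPairP P n p * Real.exp
        (∑ i, jKaspi P W1s W2s d1 d2 lam1 lam2 D1 D2 (p.1 i) (p.2 i)
          + lam1 * (n * D1 - ∑ i, d1 (p.1 i) (as i)) + lam2 * (n * D2 - ∑ i, d2 (p.1 i) (bs i))) := by
    intro p as bs
    simp only [hKeq, Finset.prod_mul_distrib, ← Real.exp_sum, iidPairP]
    congr 2
    simp only [Finset.sum_add_distrib, ← Finset.mul_sum, Finset.sum_sub_distrib]
    simp
  have hP0n : ∀ p, 0 ≤ iidPairP P n p := fun p => Finset.prod_nonneg fun i _ => hP0 _ _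
  have hdist : ∀ {β : Type} (d : 𝒳 → β → ℝ) (D : ℝ) (xs : Fin n → 𝒳) (bs : Fin n → β),
      ¬ D < distn d xs bs → 0 ≤ n * D - ∑ i, d (xs i) (bs i) := by
    intro β d D xs bs h
    rw [not_lt, distn] at h
    rcases Nat.eq_zero_or_pos n with h0 | h0
    · subst h0; simp
    · have : (0:ℝ) < n := by exact_mod_cast h0
      rw [div_le_iff₀ this] at h
      linarith
  rw [sub_le_iff_le_add]
  unfold Pr
  have hbound : ∑ p, iidPairP P n p * 0 +
      ∑ p : (Fin n → 𝒳) × (Fin n → 𝒴), Real.exp (-(n * γ)) / M *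
        ∏ i, K (p.1 i) (p.2 i) (φ1 (f p) i) (φ2 (f p, p.2) i) ≤ Real.exp (-(n * γ)) := by
    simp only [mul_zero, Finset.sum_const_zero, zero_add]
    rw [← Finset.mul_sum]
    have h1 : ∑ p : (Fin n → 𝒳) × (Fin n → 𝒴),
        ∏ i, K (p.1 i) (p.2 i) (φ1 (f p) i) (φ2 (f p, p.2) i) ≤ M := by
      calc _ ≤ ∑ p : (Fin n → 𝒳) × (Fin n → 𝒴), ∑ m : Fin M,
            ∏ i, K (p.1 i) (p.2 i) (φ1 m i) (φ2 (m, p.2) i) := by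
            refine Finset.sum_le_sum fun p _ => ?_
            exact Finset.single_le_sum
              (f := fun m => ∏ i, K (p.1 i) (p.2 i) (φ1 m i) (φ2 (m, p.2) i))
              (fun m _ => Finset.prod_nonneg fun i _ => hK0 _ _ _ _) (Finset.mem_univ (f p))
        _ = ∑ m : Fin M, ∑ p : (Fin n → 𝒳) × (Fin n → 𝒴),
            ∏ i, K (p.1 i) (p.2 i) (φ1 m i) (φ2 (m, p.2) i) := Finset.sum_comm
        _ ≤ ∑ m : Fin M, (1:ℝ) := Finset.sum_le_sum fun m _ => hmulti m
        _ = M := by simp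
    rw [div_mul_eq_mul_div, div_le_iff₀ hM]
    exact mul_le_mul_of_nonneg_left h1 (Real.exp_pos _).le
  simp only [mul_zero, Finset.sum_const_zero, zero_add] at hbound
  refine le_trans ?_ (add_le_add_right hbound _)
  rw [← Finset.sum_add_distrib]
  refine Finset.sum_le_sum fun p _ => ?_
  have hq0 : 0 ≤ Real.exp (-(n * γ)) / M *
        ∏ i, K (p.1 i) (p.2 i) (φ1 (f p) i) (φ2 (f p, p.2) i) :=
    mul_nonneg (by positivity) (Finset.prod_nonneg fun i _ => hK0 _ _ _ _)
  by_cases hbad : D1 < distn d1 p.1 (φ1 (f p)) ∨ D2 < distn d2 p.1 (φ2 (f p, p.2))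
  · have h1 : Set.indicator {p | D1 < distn d1 p.1 (φ1 (f p)) ∨ D2 < distn d2 p.1 (φ2 (f p, p.2))}
        (iidPairP P n) p = iidPairP P n p :=
      Set.indicator_of_mem (by exact hbad) _
    rw [h1]
    have h2 := Set.indicator_le_self' (s := {p : (Fin n → 𝒳) × (Fin n → 𝒴) | Real.log M + n * γ ≤
          ∑ i, jKaspi P W1s W2s d1 d2 lam1 lam2 D1 D2 (p.1 i) (p.2 i)})
          (f := iidPairP P n) (fun p _ => hP0n p) p
    linarith
  · have h1 : Set.indicator {p | D1 < distn d1 p.1 (φ1 (f p)) ∨ D2 < distn d2 p.1 (φ2 (f p, p.2))}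
        (iidPairP P n) p = 0 :=
      Set.indicator_of_notMem (by exact hbad) _
    rw [h1, zero_add]
    by_cases hmem : p ∈ {p : (Fin n → 𝒳) × (Fin n → 𝒴) | Real.log M + n * γ ≤
          ∑ i, jKaspi P W1s W2s d1 d2 lam1 lam2 D1 D2 (p.1 i) (p.2 i)}
    swap
    · rw [Set.indicator_of_notMem hmem]; exact hq0
    rw [Set.indicator_of_mem hmem, hprod]
    rw [not_or] at hbad
    have g1 := mul_nonneg hlam10 (hdist d1 D1 _ _ hbad.1)
    have g2 := mul_nonneg hlam20 (hdist d2 D2 _ _ hbad.2)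
    have hmem' : Real.log M + n * γ ≤
          ∑ i, jKaspi P W1s W2s d1 d2 lam1 lam2 D1 D2 (p.1 i) (p.2 i) := hmem
    have h3 : Real.exp (Real.log M + n * γ) ≤ Real.exp
        (∑ i, jKaspi P W1s W2s d1 d2 lam1 lam2 D1 D2 (p.1 i) (p.2 i)
          + lam1 * (n * D1 - ∑ i, d1 (p.1 i) (φ1 (f p) i))
          + lam2 * (n * D2 - ∑ i, d2 (p.1 i) (φ2 (f p, p.2) i))) :=
      Real.exp_le_exp.2 (by linarith)
    have h4 : Real.exp (-(n * γ)) / M * (iidPairP P n p * Real.exp (Real.log M + n * γ)) =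
        iidPairP P n p := by
      rw [Real.exp_add, Real.exp_log hM, Real.exp_neg]
      field_simp
    calc iidPairP P n p = _ := h4.symm
      _ ≤ _ := by
        refine mul_le_mul_of_nonneg_left (mul_le_mul_of_nonneg_left h3 (hP0n p)) (by positivity)

end
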